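/- In the model with drift μ≡0 (X(t)=K(b_H(t)) for t≥0, X(t)=c for t<0), for 0≤t≤1 one has X_ε(t) = K(b_H^ε(t)) + a_ε(t) and Ẍ_ε(t) = σ(K(b_H^ε(t))) b̈_H^ε(t) + c_ε(t), where for every δ>0, almost surely there exist C(ω)>0 and ε_0(ω)>0 such that for all 0<ε≤ε_0 and all t∈[0,1]: |a_ε(t)| ≤ C(ω) ε^{H−δ} and |c_ε(t)| ≤ C(ω)(ε^{H−2−δ} 1_{{0≤t≤ε}} + ε^{2H−2−δ} 1_{{ε≤t≤1}}). -/

import Mathlib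

open MeasureTheory ProbabilityTheory Filter Topology
open scoped FourierTransform

noncomputable section

namespace FBMPaper

variable {Ω : Type} [MeasurableSpace Ω]

/-- The constant `v_{2H}²  = (Γ(2H+1) sin(πH))⁻¹`. -/
def v2Hsq (H : ℝ) : ℝ := (Real.Gamma (2 * H + 1) * Real.sin (Real.pi * H))⁻¹

/-- Covariance function of fractional Brownian motion with Hurst parameter `H`. -/
def fbmCov (H s t : ℝ) : ℝ :=
  (1 / 2) * v2Hsq H * (|t| ^ (2 * H) + |s| ^ (2 * H) - |t - s| ^ (2 * H))

/-- `bH` is a fractional Brownian motion with Hurst parameter `H` under `P`: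
a centered Gaussian process with the fBm covariance, with almost surely continuous
sample paths which are locally `(H - δ)`-Hölder continuous for every `δ > 0`. -/
structure IsFBM (P : Measure Ω) (H : ℝ) (bH : ℝ → Ω → ℝ) : Prop where
  measurable : ∀ t, Measurable (bH t)
  gaussian : ∀ (n : ℕ) (t a : Fin n → ℝ), ∃ v : NNReal,
    P.map (fun ω => ∑ i, a i * bH (t i) ω) = gaussianReal 0 v
  covariance : ∀ s t, ∫ ω, bH s ω * bH t ω ∂P = fbmCov H s t
  cont : ∀ᵐ ω ∂P, Continuous fun t => bH t ω
  holder : ∀ δ, 0 < δ → δ < H → ∀ᵐ ω ∂P, ∀ R, 0 < R → ∃ C, 0 < C ∧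
    ∀ s ∈ Set.Icc (-R) R, ∀ t ∈ Set.Icc (-R) R,
      |bH t ω - bH s ω| ≤ C * |t - s| ^ (H - δ)

/-- `φ` is a `C²` probability density with compact support contained in `[-1,1]`. -/
structure IsKernel (φ : ℝ → ℝ) : Prop where
  smooth : ContDiff ℝ 2 φ
  nonneg : ∀ x, 0 ≤ φ x
  integral_one : ∫ x, φ x = 1
  support : Function.support φ ⊆ Set.Icc (-1) 1

/-- Smoothing by convolution: `(φ_ε * f)(t) = ε⁻¹ ∫ φ((t-x)/ε) f(x) dx`. -/
def mollify (φ : ℝ → ℝ) (ε : ℝ) (f : ℝ → ℝ) (t : ℝ) : ℝ :=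
  ε⁻¹ * ∫ x, φ ((t - x) / ε) * f x

/-- second derivative -/
def dd (f : ℝ → ℝ) : ℝ → ℝ := deriv (deriv f)

/-- `φ` seen as a complex valued function. -/
def phiC (φ : ℝ → ℝ) : ℝ → ℂ := fun x => (φ x : ℂ)

/-- `σ_{2H}² = (2π)⁻¹ ∫ |x|^{3-2H} |φ̂(-x)|² dx`. -/
def sigma2Hsq (φ : ℝ → ℝ) (H : ℝ) : ℝ :=
  (2 * Real.pi)⁻¹ * ∫ x : ℝ, |x| ^ (3 - 2 * H) * ‖𝓕 (phiC φ) (-x)‖ ^ 2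

def sigma2H (φ : ℝ → ℝ) (H : ℝ) : ℝ := Real.sqrt (sigma2Hsq φ H)

/-- `σ̃_{2H}² = (2π)⁻¹ ∫ |x|^{1-2H} |φ̂(-x)|² dx`. -/
def sigma2HtildeSq (φ : ℝ → ℝ) (H : ℝ) : ℝ :=
  (2 * Real.pi)⁻¹ * ∫ x : ℝ, |x| ^ (1 - 2 * H) * ‖𝓕 (phiC φ) (-x)‖ ^ 2

def sigma2Htilde (φ : ℝ → ℝ) (H : ℝ) : ℝ := Real.sqrt (sigma2HtildeSq φ H)

/-- `Z_ε(t) = ε^{2-H} b̈_H^ε(t) / σ_{2H}` (for a general underlying process). -/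
def Zeps (φ : ℝ → ℝ) (H : ℝ) (b : ℝ → Ω → ℝ) (ε : ℝ) (ω : Ω) (t : ℝ) : ℝ :=
  ε ^ (2 - H) * dd (mollify φ ε fun s => b s ω) t / sigma2H φ H

/-- Absolute moment `E|N|^k` of a standard Gaussian random variable. -/
def gaussAbsMoment (k : ℝ) : ℝ := ∫ x, |x| ^ k ∂(gaussianReal 0 1)

/-- `n`-th Hermite coefficient `ĝ_n = (n!)⁻¹ ∫ g(x) H_n(x) ϕ(x) dx`. -/
def hermiteCoeff (g : ℝ → ℝ) (n : ℕ) : ℝ :=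
  ((Nat.factorial n : ℝ))⁻¹ * ∫ x, g x * (Polynomial.aeval x (Polynomial.hermite n)) ∂(gaussianReal 0 1)

/-- `S_g(ε) = ε^{-1/2} ∫_0^1 g(Z_ε(u)) du`. -/
def Sg (φ : ℝ → ℝ) (H : ℝ) (b : ℝ → Ω → ℝ) (g : ℝ → ℝ) (ε : ℝ) (ω : Ω) : ℝ :=
  ε ^ (-(1 / 2 : ℝ)) * ∫ u in (0:ℝ)..1, g (Zeps φ H b ε ω u)

/-- `ρ_H(x,b,c)`: the correlation kernel at two scales. -/
def rhoH2 (φ : ℝ → ℝ) (H b c x : ℝ) : ℝ :=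
  ((b * c) ^ (2 - H) / (2 * Real.pi * sigma2Hsq φ H)) *
    (∫ y : ℝ, ((|y| ^ (3 - 2 * H) : ℝ) : ℂ) *
      (Complex.exp (Complex.I * ((x * y : ℝ) : ℂ)) *
        𝓕 (phiC φ) (-(b * y)) * 𝓕 (phiC φ) (c * y))).re

/-- `ρ_g(b,c) = (bc)^{-1/2} Σ_{n≥1} ĝ_n² n! ∫ ρ_H(x,b,c)^n dx`. -/
def rhoG (φ : ℝ → ℝ) (H : ℝ) (g : ℝ → ℝ) (b c : ℝ) : ℝ :=
  (b * c) ^ (-(1 / 2 : ℝ)) * ∑' n : ℕ,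
    (hermiteCoeff g (n + 1)) ^ 2 * (Nat.factorial (n + 1) : ℝ) * ∫ x : ℝ, (rhoH2 φ H b c x) ^ (n + 1)

/-- `ρ_H(x)`, the one-scale correlation function (second-derivative case). -/
def rhoH1 (φ : ℝ → ℝ) (H x : ℝ) : ℝ :=
  (2 * Real.pi * sigma2Hsq φ H)⁻¹ *
    (∫ y : ℝ, ((|y| ^ (3 - 2 * H) : ℝ) : ℂ) *
      (Complex.exp (Complex.I * ((x * y : ℝ) : ℂ)) * ((‖𝓕 (phiC φ) (-y)‖ ^ 2 : ℝ) : ℂ))).re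

/-- `ρ̄_H(x)`, the one-scale correlation function (first-derivative case). -/
def rhoH1tilde (φ : ℝ → ℝ) (H x : ℝ) : ℝ :=
  (2 * Real.pi * sigma2HtildeSq φ H)⁻¹ *
    (∫ y : ℝ, ((|y| ^ (1 - 2 * H) : ℝ) : ℂ) *
      (Complex.exp (Complex.I * ((x * y : ℝ) : ℂ)) * ((‖𝓕 (phiC φ) (-y)‖ ^ 2 : ℝ) : ℂ))).re

/-- `σ_g² = Σ_{n≥1} ĝ_n² n! ∫ ρ(x)^n dx` for a correlation function `ρ`. -/
def sigmaGsq (g : ℝ → ℝ) (ρ : ℝ → ℝ) : ℝ :=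
  ∑' n : ℕ, (hermiteCoeff g (n + 1)) ^ 2 * (Nat.factorial (n + 1) : ℝ) * ∫ x : ℝ, (ρ x) ^ (n + 1)

/-- the function `g_k(x) = |x|^k / E|N|^k - 1`. -/
def gk (k : ℝ) (x : ℝ) : ℝ := |x| ^ k / gaussAbsMoment k - 1

/-- the function `g_1(x) = √(π/2)|x| - 1`. -/
def g1 (x : ℝ) : ℝ := Real.sqrt (Real.pi / 2) * |x| - 1


lemma integrable_mul_of_support_Icc {ψ g : ℝ → ℝ} (hψ : Continuous ψ)
    (hs : Function.support ψ ⊆ Set.Icc (-1) 1) (hg : Continuous g) :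
    Integrable fun u => ψ u * g u :=
  (hψ.mul hg).integrable_of_hasCompactSupport
    (HasCompactSupport.mul_right (HasCompactSupport.of_support_subset_isCompact isCompact_Icc hs))

lemma mollify_eq_integral (ψ f : ℝ → ℝ) {ε : ℝ} (hε : 0 < ε) (t : ℝ) :
    mollify ψ ε f t = ∫ u, ψ u * f (t - ε * u) := by
  have h1 := Measure.integral_comp_mul_left (fun y => ψ (y / ε) * f (t - y)) ε
  have h2 := integral_sub_left_eq_self (fun x => ψ ((t - x) / ε) * f x) volume t
  simp only [sub_sub_cancel] at h2
  rw [mollify, ← h2, ← abs_of_pos (inv_pos.2 hε), ← smul_eq_mul, ← h1]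
  congr 1 with u
  rw [mul_div_cancel_left₀ _ hε.ne']

lemma mollify_const (ψ : ℝ → ℝ) {ε : ℝ} (hε : 0 < ε) (v t : ℝ) :
    mollify ψ ε (fun _ => v) t = (∫ u, ψ u) * v := by
  rw [mollify_eq_integral ψ _ hε, integral_mul_const]

lemma mollify_sub {ψ f g : ℝ → ℝ} (hψ : Continuous ψ)
    (hs : Function.support ψ ⊆ Set.Icc (-1) 1) (hf : Continuous f) (hg : Continuous g)
    {ε : ℝ} (hε : 0 < ε) (t : ℝ) :
    mollify ψ ε (fun x => f x - g x) t = mollify ψ ε f t - mollify ψ ε g t := by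
  simp only [mollify_eq_integral ψ _ hε, mul_sub]
  exact integral_sub (integrable_mul_of_support_Icc hψ hs (by fun_prop))
    (integrable_mul_of_support_Icc hψ hs (by fun_prop))

lemma mollify_const_mul (ψ f : ℝ → ℝ) (ε s t : ℝ) :
    mollify ψ ε (fun x => s * f x) t = s * mollify ψ ε f t := by
  simp only [mollify, mul_left_comm _ s, integral_const_mul]

lemma abs_mollify_le {ψ f : ℝ → ℝ} (hψ : Continuous ψ)
    (hs : Function.support ψ ⊆ Set.Icc (-1) 1) {ε : ℝ} (hε : 0 < ε) {t M : ℝ}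
    (hM : ∀ x, |x - t| ≤ ε → |f x| ≤ M) :
    |mollify ψ ε f t| ≤ (∫ u, |ψ u|) * M := by
  rw [mollify_eq_integral ψ f hε, ← integral_mul_const, ← Real.norm_eq_abs]
  refine norm_integral_le_of_norm_le ?_ (ae_of_all _ fun u => ?_)
  · exact (hψ.abs.integrable_of_hasCompactSupport
      ((HasCompactSupport.of_support_subset_isCompact isCompact_Icc hs).norm)).mul_const M
  · rw [Real.norm_eq_abs, abs_mul]
    by_cases hu : ψ u = 0
    · simp [hu]
    · have hu' : |u| ≤ 1 := abs_le.2 (hs hu)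
      refine mul_le_mul_of_nonneg_left (hM _ ?_) (abs_nonneg _)
      rw [sub_sub_cancel_left, abs_neg, abs_mul, abs_of_pos hε]
      exact mul_le_of_le_one_right hε.le hu'

lemma abs_mollify_sub_const_le {ψ f : ℝ → ℝ} (hψ : Continuous ψ)
    (hs : Function.support ψ ⊆ Set.Icc (-1) 1) (h1 : ∫ u, ψ u = 1) (hf : Continuous f)
    {ε : ℝ} (hε : 0 < ε) {t v M : ℝ} (hM : ∀ x, |x - t| ≤ ε → |f x - v| ≤ M) :
    |mollify ψ ε f t - v| ≤ (∫ u, |ψ u|) * M := by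
  have h := mollify_sub hψ hs hf (continuous_const (y := v)) hε t
  rw [mollify_const ψ hε, h1, one_mul] at h
  rw [← h]
  exact abs_mollify_le hψ hs hε hM

lemma support_deriv_subset_Icc {ψ : ℝ → ℝ} (hs : Function.support ψ ⊆ Set.Icc (-1) 1) :
    Function.support (deriv ψ) ⊆ Set.Icc (-1) 1 :=
  support_deriv_subset.trans (closure_minimal hs isClosed_Icc)

lemma hasDerivAt_mollify {ψ f : ℝ → ℝ} (hψ : ContDiff ℝ 1 ψ)
    (hs : Function.support ψ ⊆ Set.Icc (-1) 1) (hf : Continuous f) {ε : ℝ} (hε : 0 < ε) (t : ℝ) :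
    HasDerivAt (mollify ψ ε f) (ε⁻¹ * mollify (deriv ψ) ε f t) t := by
  have hsc : HasCompactSupport fun x => ψ (x / ε) := by
    refine HasCompactSupport.of_support_subset_isCompact (isCompact_Icc (a := -ε) (b := ε)) ?_
    intro x hx
    obtain ⟨h1, h2⟩ := hs hx
    rw [le_div_iff₀ hε] at h1
    rw [div_le_iff₀ hε] at h2
    constructor <;> linarith
  have hcd : ContDiff ℝ 1 fun x => ψ (x / ε) := hψ.comp (contDiff_id.div_const ε)
  have key := (hsc.hasDerivAt_convolution_left (ContinuousLinearMap.mul ℝ ℝ) (μ := volume) hcd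
    hf.locallyIntegrable t).const_mul ε⁻¹
  have hd : deriv (fun x => ψ (x / ε)) = fun x => ε⁻¹ * deriv ψ (x / ε) := by
    funext x
    have := (((hψ.differentiable one_ne_zero) (x / ε)).hasDerivAt.comp x
      ((hasDerivAt_id x).div_const ε)).deriv
    simp only [Function.comp_def, id] at this
    rw [this]; ring
  have e (χ : ℝ → ℝ) (t : ℝ) : MeasureTheory.convolution χ f (ContinuousLinearMap.mul ℝ ℝ) volume t
      = ∫ x, χ (t - x) * f x := by
    rw [MeasureTheory.convolution_eq_swap]; rfl
  have e1 : mollify ψ ε f = fun t => ε⁻¹ * MeasureTheory.convolution (fun x => ψ (x / ε)) f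
      (ContinuousLinearMap.mul ℝ ℝ) volume t := by
    funext t; rw [e]; rfl
  rw [e, hd] at key
  simp only [mul_assoc, integral_const_mul] at key
  rw [e1]
  exact key

lemma dd_mollify {ψ f : ℝ → ℝ} (hψ : ContDiff ℝ 2 ψ)
    (hs : Function.support ψ ⊆ Set.Icc (-1) 1) (hf : Continuous f) {ε : ℝ} (hε : 0 < ε) (t : ℝ) :
    dd (mollify ψ ε f) t = ε⁻¹ * (ε⁻¹ * mollify (deriv (deriv ψ)) ε f t) := by
  have hψ' : ContDiff ℝ 1 (deriv ψ) := hψ.deriv' (n := 1)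
  have h : deriv (mollify ψ ε f) = fun t => ε⁻¹ * mollify (deriv ψ) ε f t :=
    funext fun t => (hasDerivAt_mollify (hψ.of_le one_le_two) hs hf hε t).deriv
  rw [dd, h]
  exact ((hasDerivAt_mollify hψ' (support_deriv_subset_Icc hs) hf hε t).const_mul _).deriv

lemma integral_deriv_eq_zero_of_support {ψ : ℝ → ℝ} (hψ : ContDiff ℝ 1 ψ)
    (hs : Function.support ψ ⊆ Set.Icc (-1) 1) : ∫ u, deriv ψ u = 0 := by
  have hc := HasCompactSupport.of_support_subset_isCompact isCompact_Icc hs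
  exact integral_eq_zero_of_hasDerivAt_of_integrable
    (fun x => ((hψ.differentiable one_ne_zero) x).hasDerivAt)
    ((hψ.continuous_deriv le_rfl).integrable_of_hasCompactSupport hc.deriv)
    (hψ.continuous.integrable_of_hasCompactSupport hc)

lemma exists_lipschitz_Icc {f : ℝ → ℝ} (hf : ContDiff ℝ 1 f) (M : ℝ) :
    ∃ L, 0 ≤ L ∧ ∀ x ∈ Set.Icc (-M) M, ∀ y ∈ Set.Icc (-M) M, |f x - f y| ≤ L * |x - y| := by
  obtain ⟨L, hL⟩ := hf.contDiffOn.exists_lipschitzOnWith one_ne_zero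
    (convex_Icc (-M) M) isCompact_Icc
  exact ⟨L, L.2, fun x hx y hy => hL.dist_le_mul x hx y hy⟩

/-- First-order expansion with the slope taken at a nearby point `w`. -/
lemma abs_sub_sub_mul_le {K g : ℝ → ℝ} (hK : ∀ x, HasDerivAt K (g x) x) {M L r w : ℝ}
    (hL0 : 0 ≤ L)
    (hL : ∀ x ∈ Set.Icc (-M) M, ∀ y ∈ Set.Icc (-M) M, |g x - g y| ≤ L * |x - y|)
    (hw : w ∈ Set.Icc (-M) M) {y z : ℝ} (hy : y ∈ Set.Icc (-M) M) (hz : z ∈ Set.Icc (-M) M)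
    (hyw : |y - w| ≤ r) (hzw : |z - w| ≤ r) :
    |K y - K z - g w * (y - z)| ≤ L * r * |y - z| := by
  have hconv : Convex ℝ (Set.Icc (-M) M ∩ Set.Icc (w - r) (w + r)) :=
    (convex_Icc _ _).inter (convex_Icc _ _)
  have mem {x : ℝ} (hx : |x - w| ≤ r) : x ∈ Set.Icc (w - r) (w + r) := by
    rw [abs_le] at hx; constructor <;> linarith
  have := hconv.norm_image_sub_le_of_norm_hasDerivWithin_le
    (f := fun x => K x - g w * x) (f' := fun x => g x - g w) (C := L * r)
    (fun x _ => by
      simpa using ((hK x).fun_sub ((hasDerivAt_id x).const_mul (g w))).hasDerivWithinAt)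
    (fun x hx => (hL x hx.1 w hw).trans (mul_le_mul_of_nonneg_left
      (abs_le.2 ⟨by linarith [hx.2.1], by linarith [hx.2.2]⟩) hL0))
    ⟨hz, mem hzw⟩ ⟨hy, mem hyw⟩
  simp only [Real.norm_eq_abs] at this
  convert this using 2
  ring

lemma IsFBM.ae_zero {P : Measure Ω} [IsProbabilityMeasure P] {H : ℝ} (hH : 0 < H)
    {bH : ℝ → Ω → ℝ} (hbH : IsFBM P H bH) : ∀ᵐ ω ∂P, bH 0 ω = 0 := by
  obtain ⟨v, hv⟩ := hbH.gaussian 1 (fun _ => 0) (fun _ => 1)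
  simp only [Finset.univ_unique, one_mul, Finset.sum_const, Finset.card_singleton, one_smul] at hv
  have hm : MemLp (bH 0) 2 P := by
    have h := memLp_id_gaussianReal (μ := 0) (v := v) 2
    rw [← hv] at h
    exact (memLp_map_measure_iff aestronglyMeasurable_id (hbH.measurable 0).aemeasurable).1 h
  have hi : Integrable (fun ω => bH 0 ω * bH 0 ω) P := hm.integrable_mul hm
  have h0 : ∫ ω, bH 0 ω * bH 0 ω ∂P = 0 := by
    rw [hbH.covariance, fbmCov]
    simp [Real.zero_rpow (show 2 * H ≠ 0 by positivity)]
  rw [integral_eq_zero_iff_of_nonneg (fun ω => mul_self_nonneg _) hi] at h0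
  filter_upwards [h0] with ω hω
  exact mul_self_eq_zero.1 hω

/-- Pathwise estimates for a Hölder continuous path `b` and its image `K ∘ b` stopped at the
left of `0`. -/
lemma exists_bound_of_holder {φ : ℝ → ℝ} (hφ : IsKernel φ) {K g : ℝ → ℝ} (hg : ContDiff ℝ 1 g)
    (hK : ∀ x, HasDerivAt K (g x) x) {b : ℝ → ℝ} (hb : Continuous b) {γ C : ℝ}
    (hγ : 0 ≤ γ) (hC : 0 < C)
    (hol : ∀ s ∈ Set.Icc (-2 : ℝ) 2, ∀ t ∈ Set.Icc (-2 : ℝ) 2, |b t - b s| ≤ C * |t - s| ^ γ) :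
    ∃ D > 0, ∀ ε, 0 < ε → ε ≤ 1 → ∀ t ∈ Set.Icc (0 : ℝ) 1,
      |mollify φ ε (fun x => K (b (max x 0))) t - K (mollify φ ε b t)| ≤ D * ε ^ γ ∧
      |dd (mollify φ ε fun x => K (b (max x 0))) t
          - g (mollify φ ε b t) * dd (mollify φ ε b) t| ≤ D * ε ^ (γ - 2) ∧
      (ε ≤ t → |dd (mollify φ ε fun x => K (b (max x 0))) t
          - g (mollify φ ε b t) * dd (mollify φ ε b) t| ≤ D * ε ^ (2 * γ - 2)) := by
  have hKd : Differentiable ℝ K := fun x => (hK x).differentiableAt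
  have hK1 : ContDiff ℝ 1 K := contDiff_one_iff_deriv.2
    ⟨hKd, by rw [show deriv K = g from funext fun x => (hK x).deriv]; exact hg.continuous⟩
  obtain ⟨M, hM⟩ := isCompact_Icc.exists_bound_of_continuousOn
    (hb.continuousOn (s := Set.Icc (-2 : ℝ) 2))
  obtain ⟨L₁, hL₁0, hL₁⟩ := exists_lipschitz_Icc hK1 M
  obtain ⟨L₂, hL₂0, hL₂⟩ := exists_lipschitz_Icc hg M
  obtain ⟨S, hS⟩ := isCompact_Icc.exists_bound_of_continuousOn
    (hg.continuous.continuousOn (s := Set.Icc (-M) M))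
  have hφ'' : Continuous (deriv (deriv φ)) :=
    (hφ.smooth.deriv' (n := 1)).continuous_deriv le_rfl
  have hs'' := support_deriv_subset_Icc (support_deriv_subset_Icc hφ.support)
  have hint : ∫ u, deriv (deriv φ) u = 0 :=
    integral_deriv_eq_zero_of_support (hφ.smooth.deriv' (n := 1))
      (support_deriv_subset_Icc hφ.support)
  have habs : ∫ u, |φ u| = 1 := by
    simp only [abs_of_nonneg (hφ.nonneg _), hφ.integral_one]
  set B := ∫ u, |deriv (deriv φ) u|
  have hB0 : 0 ≤ B := integral_nonneg fun _ => abs_nonneg _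
  have hbM {x : ℝ} (hx : x ∈ Set.Icc (-2 : ℝ) 2) : b x ∈ Set.Icc (-M) M := abs_le.1 (hM x hx)
  have hS0 : 0 ≤ S := (norm_nonneg _).trans (hS _ (hbM (x := 0) (by norm_num)))
  have hX : Continuous fun x => K (b (max x 0)) :=
    hKd.continuous.comp (hb.comp (continuous_id.max continuous_const))
  refine ⟨2 * L₁ * C + B * (L₁ * C + S * C) + 2 * B * L₂ * C ^ 2 + 1, by positivity,
    fun ε hε hε1 t ht => ?_⟩
  set h := ε ^ γ
  have hh0 : 0 < h := Real.rpow_pos_of_pos hε γ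
  have ht2 : t ∈ Set.Icc (-2 : ℝ) 2 := ⟨by linarith [ht.1], by linarith [ht.2]⟩
  have hnear {x : ℝ} (hx : |x - t| ≤ ε) : x ∈ Set.Icc (-2 : ℝ) 2 := by
    rw [abs_le] at hx; constructor <;> linarith [ht.1, ht.2]
  have hbh {x : ℝ} (hx : |x - t| ≤ ε) : |b x - b t| ≤ C * h :=
    (hol t ht2 x (hnear hx)).trans
      (mul_le_mul_of_nonneg_left (Real.rpow_le_rpow (abs_nonneg _) hx hγ) hC.le)
  have hmax {x : ℝ} (hx : |x - t| ≤ ε) : |max x 0 - t| ≤ ε := by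
    rw [abs_le] at hx ⊢
    have := max_le (show x ≤ t + ε by linarith) (show 0 ≤ t + ε by linarith [ht.1])
    exact ⟨by linarith [le_max_left x 0], by linarith⟩
  have hXh {x : ℝ} (hx : |x - t| ≤ ε) : |K (b (max x 0)) - K (b t)| ≤ L₁ * (C * h) :=
    (hL₁ _ (hbM (hnear (hmax hx))) _ (hbM ht2)).trans
      (mul_le_mul_of_nonneg_left (hbh (hmax hx)) hL₁0)
  set w := mollify φ ε b t
  have hw : w ∈ Set.Icc (-M) M := by
    have := abs_mollify_le hφ.smooth.continuous hφ.support hε (f := b) (t := t) (M := M)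
      fun x hx => hM x (hnear hx)
    rw [habs, one_mul] at this
    exact abs_le.1 this
  have hwb : |w - b t| ≤ C * h := by
    have := abs_mollify_sub_const_le hφ.smooth.continuous hφ.support hφ.integral_one hb hε
      (t := t) fun x hx => hbh hx
    rwa [habs, one_mul] at this
  have hdd : dd (mollify φ ε fun x => K (b (max x 0))) t - g w * dd (mollify φ ε b) t
      = ε⁻¹ * (ε⁻¹ * mollify (deriv (deriv φ)) ε
        (fun x => K (b (max x 0)) - K (b t) - g w * (b x - b t)) t) := by
    rw [dd_mollify hφ.smooth hφ.support hX hε, dd_mollify hφ.smooth hφ.support hb hε,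
      mollify_sub hφ'' hs'' (f := fun x => K (b (max x 0)) - K (b t))
        (g := fun x => g w * (b x - b t)) (by fun_prop) (by fun_prop) hε,
      mollify_sub hφ'' hs'' hX continuous_const hε, mollify_const_mul,
      mollify_sub hφ'' hs'' hb continuous_const hε, mollify_const _ hε, mollify_const _ hε, hint]
    ring
  have hscale {N : ℝ} (hN : ∀ x, |x - t| ≤ ε →
      |K (b (max x 0)) - K (b t) - g w * (b x - b t)| ≤ N) :
      |dd (mollify φ ε fun x => K (b (max x 0))) t - g w * dd (mollify φ ε b) t|
        ≤ B * N * ε ^ (-2 : ℝ) := by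
    rw [hdd, abs_mul, abs_mul, abs_of_pos (inv_pos.2 hε), Real.rpow_neg hε.le, Real.rpow_two]
    calc _ ≤ ε⁻¹ * (ε⁻¹ * (B * N)) := by
          gcongr
          exact abs_mollify_le hφ'' hs'' hε hN
      _ = _ := by rw [sq, mul_inv]; ring
  have e0 : 0 < ε ^ (-2 : ℝ) := Real.rpow_pos_of_pos hε _
  have e1 : ε ^ (γ - 2) = h * ε ^ (-2 : ℝ) := by rw [sub_eq_add_neg, Real.rpow_add hε]
  have e2 : ε ^ (2 * γ - 2) = h ^ 2 * ε ^ (-2 : ℝ) := by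
    rw [sub_eq_add_neg, Real.rpow_add hε, mul_comm 2 γ, Real.rpow_mul hε.le, Real.rpow_two]
  have p1 : 0 ≤ L₁ * C := by positivity
  have p2 : 0 ≤ B * (L₁ * C + S * C) := by positivity
  have p3 : 0 ≤ 2 * B * L₂ * C ^ 2 := by positivity
  refine ⟨?_, ?_, fun hεt => ?_⟩
  · have h1 := abs_mollify_sub_const_le hφ.smooth.continuous hφ.support hφ.integral_one hX hε
      (t := t) fun x hx => hXh hx
    rw [habs, one_mul] at h1
    have h2 : |K (b t) - K w| ≤ L₁ * (C * h) :=
      (hL₁ _ (hbM ht2) _ hw).trans (mul_le_mul_of_nonneg_left (by rwa [abs_sub_comm]) hL₁0)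
    calc _ ≤ L₁ * (C * h) + L₁ * (C * h) := (abs_sub_le _ (K (b t)) _).trans (add_le_add h1 h2)
      _ = (2 * L₁ * C) * h := by ring
      _ ≤ _ := by gcongr; linarith
  · refine (hscale (N := L₁ * (C * h) + S * (C * h)) fun x hx => ?_).trans ?_
    · refine (abs_sub _ _).trans (add_le_add (hXh hx) ?_)
      rw [abs_mul]
      exact mul_le_mul (hS w hw) (hbh hx) (abs_nonneg _) hS0
    · rw [e1, ← mul_assoc (_ + 1)]
      refine mul_le_mul_of_nonneg_right ?_ e0.le
      calc _ = (B * (L₁ * C + S * C)) * h := by ring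
        _ ≤ _ := by gcongr; linarith
  · refine (hscale (N := L₂ * (2 * (C * h)) * (C * h)) fun x hx => ?_).trans ?_
    · have hx0 : max x 0 = x := max_eq_left (by linarith [(abs_le.1 hx).1])
      rw [hx0]
      have hxw : |b x - w| ≤ 2 * (C * h) := by
        have := abs_sub_le (b x) (b t) w
        rw [abs_sub_comm (b t) w] at this
        linarith [hbh hx]
      refine (abs_sub_sub_mul_le hK hL₂0 hL₂ hw (hbM (hnear hx)) (hbM ht2) hxw ?_).trans ?_
      · rw [abs_sub_comm]; linarith [mul_pos hC hh0]
      · exact mul_le_mul_of_nonneg_left (hbh hx) (by positivity)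
    · rw [e2, ← mul_assoc (_ + 1)]
      refine mul_le_mul_of_nonneg_right ?_ e0.le
      calc _ = (2 * B * L₂ * C ^ 2) * h ^ 2 := by ring
        _ ≤ _ := by gcongr; linarith

/-- Lemma 3.2: in the model with drift `μ ≡ 0`, on `[0,1]` one has
`X_ε(t) = K(b_H^ε(t)) + a_ε(t)` and `Ẍ_ε(t) = σ(K(b_H^ε(t))) b̈_H^ε(t) + c_ε(t)` with
`|a_ε(t)| ≤ C(ω) ε^{H-δ}` and
`|c_ε(t)| ≤ C(ω)(ε^{H-2-δ} 1_{[0,ε]}(t) + ε^{2H-2-δ} 1_{[ε,1]}(t))`. -/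
theorem statement16 (P : Measure Ω) [IsProbabilityMeasure P]
    (H : ℝ) (hH0 : 1/2 < H) (hH1 : H < 1)
    (bH : ℝ → Ω → ℝ) (hbH : IsFBM P H bH)
    (φ : ℝ → ℝ) (hφ : IsKernel φ)
    (σf : ℝ → ℝ) (hσf : ContDiff ℝ 1 σf) (hσfpos : ∀ x, 0 < σf x)
    (x₀ : ℝ) (K : ℝ → ℝ) (hK : ∀ t, HasDerivAt K (σf (K t)) t) (hK0 : K 0 = x₀)
    (X : ℝ → Ω → ℝ) (hX : ∀ t ω, X t ω = if 0 ≤ t then K (bH t ω) else x₀)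
    (a c : ℝ → Ω → ℝ → ℝ)
    (ha : ∀ ε ω t, a ε ω t
        = mollify φ ε (fun s => X s ω) t - K (mollify φ ε (fun s => bH s ω) t))
    (hc : ∀ ε ω t, c ε ω t
        = dd (mollify φ ε fun s => X s ω) t
          - σf (K (mollify φ ε (fun s => bH s ω) t)) * dd (mollify φ ε fun s => bH s ω) t)
    (δ : ℝ) (hδ : 0 < δ) :
    ∀ᵐ ω ∂P, ∃ C > 0, ∃ ε₀ > 0, ∀ ε : ℝ, 0 < ε → ε ≤ ε₀ → ∀ t ∈ Set.Icc (0:ℝ) 1,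
      mollify φ ε (fun s => X s ω) t
        = K (mollify φ ε (fun s => bH s ω) t) + a ε ω t ∧
      dd (mollify φ ε fun s => X s ω) t
        = σf (K (mollify φ ε (fun s => bH s ω) t)) * dd (mollify φ ε fun s => bH s ω) t
          + c ε ω t ∧
      |a ε ω t| ≤ C * ε ^ (H - δ) ∧
      |c ε ω t| ≤ C * (Set.indicator (Set.Icc 0 ε) (fun _ => ε ^ (H - 2 - δ)) t
          + Set.indicator (Set.Icc ε 1) (fun _ => ε ^ (2 * H - 2 - δ)) t) := by
  obtain ⟨δ', hδ'0, hδ'H, hδ'δ⟩ : ∃ δ', 0 < δ' ∧ δ' < H ∧ 2 * δ' ≤ δ := by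
    refine ⟨min (δ / 2) (H / 2), lt_min (by linarith) (by linarith), ?_, ?_⟩
    · linarith [min_le_right (δ / 2) (H / 2)]
    · linarith [min_le_left (δ / 2) (H / 2)]
  have hKc : Continuous K := continuous_iff_continuousAt.2 fun x => (hK x).continuousAt
  have hg : ContDiff ℝ 1 fun x => σf (K x) := by
    refine hσf.comp (contDiff_one_iff_deriv.2 ⟨fun x => (hK x).differentiableAt, ?_⟩)
    rw [show deriv K = fun x => σf (K x) from funext fun x => (hK x).deriv]
    exact hσf.continuous.comp hKc
  filter_upwards [hbH.ae_zero (by linarith), hbH.cont, hbH.holder δ' hδ'0 hδ'H]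
    with ω h0 hcont hhol
  obtain ⟨C, hC, hol⟩ := hhol 2 two_pos
  obtain ⟨D, hD, hbound⟩ := exists_bound_of_holder hφ hg hK hcont (by linarith) hC hol
  have hXω : (fun s => X s ω) = fun s => K (bH (max s 0) ω) := by
    funext s
    rw [hX]
    split_ifs with hs
    · rw [max_eq_left hs]
    · rw [max_eq_right (not_le.1 hs).le, h0, hK0]
  refine ⟨D, hD, 1, one_pos, fun ε hε hε1 t ht => ?_⟩
  obtain ⟨b1, b2, b3⟩ := hbound ε hε hε1 t ht
  have mono {p q : ℝ} (h : q ≤ p) : D * ε ^ p ≤ D * ε ^ q :=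
    mul_le_mul_of_nonneg_left (Real.rpow_le_rpow_of_exponent_ge hε hε1 h) hD.le
  refine ⟨by rw [ha]; ring, by rw [hc]; ring, ?_, ?_⟩
  · rw [ha, hXω]
    exact b1.trans (mono (by linarith))
  · rw [hc, hXω]
    rcases lt_or_ge t ε with hlt | hge
    · rw [Set.indicator_of_mem (show t ∈ Set.Icc 0 ε from ⟨ht.1, hlt.le⟩),
        Set.indicator_of_notMem (fun h => absurd h.1 (not_le.2 hlt)), add_zero]
      exact b2.trans (mono (by linarith))
    · rw [Set.indicator_of_mem (show t ∈ Set.Icc ε 1 from ⟨hge, ht.2⟩)]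
      refine ((b3 hge).trans (mono (q := 2 * H - 2 - δ) (by linarith))).trans ?_
      gcongr
      exact le_add_of_nonneg_left
        (Set.indicator_nonneg (fun _ _ => (Real.rpow_pos_of_pos hε _).le) _)

end FBMPaper
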